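/- Let d ≥ 2 be an even integer and let n be a positive integer with n ≡ d+1 (mod 2d). Then Σ_{k=0}^{(dn+n−1)/(2d)} [3dk+1]_q · (q,−q,−q^d; q^{2d})_k (q,q,q^{d−1}; q^d)_k / ((q^d,−q,−q^d; q^d)_k (q^{2d},q^{2d},q^{d+2}; q^{2d})_k) · q^{dk} ≡ 0 (mod Φ_n(q)^3). -/

import Mathlib

open Finset

noncomputable section

abbrev R1 : Type := Polynomial ℚ
abbrev K1 : Type := FractionRing R1

/-- The variable `q` as a rational function in `ℚ(q)`. -/
def qv : K1 := algebraMap R1 K1 Polynomial.X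

/-- The q-shifted factorial `(a; q)_k = (1-a)(1-aq)⋯(1-aq^{k-1})`. -/
def qPoch {R : Type*} [CommRing R] (a q : R) (k : ℕ) : R :=
  ∏ j ∈ Finset.range k, (1 - a * q ^ j)

/-- The q-integer `[m]_q = (1 - q^m)/(1 - q)`. -/
def qInt {K : Type*} [Field K] (q : K) (m : ℤ) : K := (1 - q ^ m) / (1 - q)

/-- `A ≡ B (mod M)`: the polynomial `M` divides the numerator of the reduced form
of the rational function `A - B`. -/
def CongrMod1 (A B : K1) (M : R1) : Prop :=
  ∃ f g : R1, g ≠ 0 ∧ (∀ p : R1, Prime p → p ∣ g → ¬ p ∣ M) ∧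
    (A - B) * algebraMap R1 K1 g = algebraMap R1 K1 M * algebraMap R1 K1 f

section Quadratic

variable {F : Type*} [Field F]

/-- Ratio of consecutive terms (up to the very-well-poised factor and the argument). -/
def termRatio (a b c q y : F) : F :=
  ((1 - a ^ 2 * y ^ 4) * (1 + q * y ^ 2) * (1 - b * y) * (1 - c * y) * (b * c - a * q * y)) /
    ((1 - q ^ 2 * y ^ 2) * (1 + a * y) * (b - a * q ^ 2 * y ^ 2) * (c - a * q ^ 2 * y ^ 2) *
      (1 - b * c * q * y ^ 2))

/-- The product of the first `k` term ratios. -/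
def termProd (a b c q : F) (k : ℕ) : F := ∏ j ∈ range k, termRatio a b c q (q ^ j)

/-- The `k`-th term of the quadratic basic hypergeometric sum with parameters `a`, `b`, `c`. -/
def qTerm (a b c q : F) (k : ℕ) : F := (1 - a * (q ^ k) ^ 3) * q ^ k * termProd a b c q k

/-- Telescoping of `T k - l * T' k = G (k + 1) - G k`, with `H k` in place of `G (k + 1)`. -/
theorem sum_sub_mul_sum_eq (T T' G H : ℕ → F) (l : F) (M : ℕ) (h0 : G 0 = 0)
    (hT : ∀ k ≤ M, T k - l * T' k = H k - G k) (hG : ∀ k < M, G (k + 1) = H k) :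
    ∑ k ∈ range (M + 1), T k - l * ∑ k ∈ range (M + 1), T' k = H M := by
  rw [mul_sum, ← sum_sub_distrib, sum_congr rfl fun k hk ↦ hT k (by simp at hk; omega),
    sum_sub_distrib, sum_range_succ, sum_range_succ', h0,
    sum_congr rfl fun k hk ↦ hG k (by simpa using hk)]
  ring

theorem mul_prod_eq_mul_prod (ρ r r' : ℕ → F) (M : ℕ)
    (h : ∀ j < M, ρ j * r' j = ρ (j + 1) * r j) :
    ∀ k ≤ M, ρ 0 * ∏ j ∈ range k, r' j = ρ k * ∏ j ∈ range k, r j := by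
  intro k
  induction k with
  | zero => simp
  | succ k ih =>
    intro hk
    rw [prod_range_succ, prod_range_succ, ← mul_assoc, ih (by omega), mul_right_comm,
      h k (by omega)]
    ring

theorem termRatio_b_shift {a b c q y : F}
    (h1 : b * c * q - a * y ≠ 0) (h2 : b * c - a * y ≠ 0) (h3 : 1 - b * c * q * y ^ 2 ≠ 0)
    (h3' : 1 - b * c * q * (q * y) ^ 2 ≠ 0)
    (h4 : b * c - a * (q * y) ≠ 0) (h5 : 1 - q ^ 2 * y ^ 2 ≠ 0)
    (h6 : 1 + a * y ≠ 0) (h7 : b - a * (q * y) ^ 2 ≠ 0) (h7' : b - a * y ^ 2 ≠ 0)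
    (h8 : c - a * q ^ 2 * y ^ 2 ≠ 0) (hq : q ≠ 0) :
    ((1 - b * y) * (1 - b * q * y) * (b - a * y ^ 2)) /
      ((b * c * q - a * y) * (b * c - a * y) * (1 - b * c * q * y ^ 2)) *
      termRatio a (b * q ^ 2) c q y =
    ((1 - b * (q * y)) * (1 - b * q * (q * y)) * (b - a * (q * y) ^ 2)) /
      ((b * c * q - a * (q * y)) * (b * c - a * (q * y)) * (1 - b * c * q * (q * y) ^ 2)) *
      termRatio a b c q y := by
  have e1 : b * q ^ 2 * c - a * q * y = q * (b * c * q - a * y) := by ring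
  have e2 : b * q ^ 2 - a * q ^ 2 * y ^ 2 = q ^ 2 * (b - a * y ^ 2) := by ring
  have e3 : b * c * q - a * (q * y) = q * (b * c - a * y) := by ring
  have e4 : b * c - a * q * y = b * c - a * (q * y) := by ring
  have e6 : 1 - b * q ^ 2 * c * q * y ^ 2 = 1 - b * c * q * (q * y) ^ 2 := by ring
  have e7 : b - a * q ^ 2 * y ^ 2 = b - a * (q * y) ^ 2 := by ring
  have e8 : 1 - b * q ^ 2 * y = 1 - b * q * (q * y) := by ring
  have e9 : 1 - b * (q * y) = 1 - b * q * y := by ring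
  unfold termRatio
  rw [e1, e2, e3, e4, e6, e7, e8, e9]
  generalize b * c * q - a * y = A1 at *
  generalize b * c - a * y = A2 at *
  generalize 1 - b * c * q * y ^ 2 = A3 at *
  generalize 1 - b * c * q * (q * y) ^ 2 = A4 at *
  generalize b * c - a * (q * y) = A5 at *
  generalize 1 - q ^ 2 * y ^ 2 = A6 at *
  generalize 1 + a * y = A7 at *
  generalize b - a * (q * y) ^ 2 = A8 at *
  generalize b - a * y ^ 2 = A9 at *
  generalize c - a * q ^ 2 * y ^ 2 = A10 at *
  clear e1 e2 e3 e4 e6 e7 e8 e9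
  field_simp

theorem b_shift_certificate {a b c q y : F}
    (h1 : b * c * q - a * y ≠ 0) (h2 : b * c - a * y ≠ 0) (h3 : 1 - b * c * q * y ^ 2 ≠ 0)
    (h4 : b ^ 2 - 1 ≠ 0) (h5 : b * q + a ≠ 0) :
    (1 - a * y ^ 3) * y +
      (b * c * q + a) * (b * c + 1) * (b * c * q - a) / ((b ^ 2 - 1) * (b * q + a)) *
       (((1 - b * y) * (1 - b * q * y) * (b - a * y ^ 2)) /
        ((b * c * q - a * y) * (b * c - a * y) * (1 - b * c * q * y ^ 2))) *
        ((1 - a * y ^ 3) * y) =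
     (a - b ^ 2 * c * q) * b * (1 - a ^ 2 * y ^ 4) * (1 + q * y ^ 2) * (1 - b * y) * (1 - c * y) /
       ((b ^ 2 - 1) * (b * q + a) * (b * c - a * y) * (1 - b * c * q * y ^ 2)) -
     (a - b ^ 2 * c * q) * b * (1 - y ^ 2) * (q + a * y) * (b - a * y ^ 2) * (c - a * y ^ 2) /
       ((b ^ 2 - 1) * (b * q + a) * (b * c - a * y) * (b * c * q - a * y)) := by
  have key : (1 - a * y ^ 3) * y * ((b ^ 2 - 1) * (b * q + a) * (b * c * q - a * y) *
      (b * c - a * y) * (1 - b * c * q * y ^ 2)) + (b * c * q + a) * (b * c + 1) * (b * c * q - a) *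
      ((1 - b * y) * (1 - b * q * y) * (b - a * y ^ 2)) * ((1 - a * y ^ 3) * y) =
      (a - b ^ 2 * c * q) * b * (1 - a ^ 2 * y ^ 4) * (1 + q * y ^ 2) * (1 - b * y) * (1 - c * y) *
        (b * c * q - a * y) - (a - b ^ 2 * c * q) * b * (1 - y ^ 2) * (q + a * y) * (b - a * y ^ 2) *
        (c - a * y ^ 2) * (1 - b * c * q * y ^ 2) := by ring
  generalize b * c * q - a * y = A1 at *
  generalize b * c - a * y = A2 at *
  generalize 1 - b * c * q * y ^ 2 = A3 at *
  generalize b ^ 2 - 1 = A4 at *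
  generalize b * q + a = A5 at *
  generalize (a - b ^ 2 * c * q) * b * (1 - a ^ 2 * y ^ 4) * (1 + q * y ^ 2) * (1 - b * y) *
    (1 - c * y) = B1 at *
  generalize (a - b ^ 2 * c * q) * b * (1 - y ^ 2) * (q + a * y) * (b - a * y ^ 2) *
    (c - a * y ^ 2) = B2 at *
  generalize (b * c * q + a) * (b * c + 1) * (b * c * q - a) = B3 at *
  generalize (1 - b * y) * (1 - b * q * y) * (b - a * y ^ 2) = B4 at *
  generalize (1 - a * y ^ 3) * y = B5 at *
  field_simp
  linear_combination key

theorem b_shift_boundary {a b c q y : F}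
    (h2 : b * c - a * y ≠ 0) (h3 : 1 - b * c * q * y ^ 2 ≠ 0)
    (h4 : b * c - a * (q * y) ≠ 0) (h5 : 1 - q ^ 2 * y ^ 2 ≠ 0)
    (h6 : 1 + a * y ≠ 0) (h7 : b - a * (q * y) ^ 2 ≠ 0)
    (h8 : c - a * q ^ 2 * y ^ 2 ≠ 0) (hq : q ≠ 0)
    (h9 : b ^ 2 - 1 ≠ 0) (h10 : b * q + a ≠ 0) :
    (a - b ^ 2 * c * q) * b * (1 - (q * y) ^ 2) * (q + a * (q * y)) * (b - a * (q * y) ^ 2) *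
        (c - a * (q * y) ^ 2) /
       ((b ^ 2 - 1) * (b * q + a) * (b * c - a * (q * y)) * (b * c * q - a * (q * y))) *
       termRatio a b c q y =
     (a - b ^ 2 * c * q) * b * (1 - a ^ 2 * y ^ 4) * (1 + q * y ^ 2) * (1 - b * y) * (1 - c * y) /
       ((b ^ 2 - 1) * (b * q + a) * (b * c - a * y) * (1 - b * c * q * y ^ 2)) := by
  have e3 : b * c * q - a * (q * y) = q * (b * c - a * y) := by ring
  have e4 : b * c - a * q * y = b * c - a * (q * y) := by ring
  have e5 : 1 - (q * y) ^ 2 = 1 - q ^ 2 * y ^ 2 := by ring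
  have e7 : b - a * q ^ 2 * y ^ 2 = b - a * (q * y) ^ 2 := by ring
  have e8 : c - a * (q * y) ^ 2 = c - a * q ^ 2 * y ^ 2 := by ring
  have e9 : q + a * (q * y) = q * (1 + a * y) := by ring
  unfold termRatio
  rw [e3, e4, e5, e7, e8, e9]
  generalize b * c - a * y = A2 at *
  generalize 1 - b * c * q * y ^ 2 = A3 at *
  generalize b * c - a * (q * y) = A5 at *
  generalize 1 - q ^ 2 * y ^ 2 = A6 at *
  generalize 1 + a * y = A7 at *
  generalize b - a * (q * y) ^ 2 = A8 at *
  generalize c - a * q ^ 2 * y ^ 2 = A10 at *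
  generalize b ^ 2 - 1 = A11 at *
  generalize b * q + a = A12 at *
  clear e3 e4 e5 e7 e8 e9
  field_simp

theorem termRatio_a_shift {a b c q y : F}
    (h1 : 1 + a * y ≠ 0) (h2 : 1 + a * q * y ≠ 0) (h2' : 1 + a * q * (q * y) ≠ 0)
    (h3 : b - a * q ^ 2 * y ^ 2 ≠ 0) (h3' : b - a * q ^ 2 * (q * y) ^ 2 ≠ 0)
    (h4 : c - a * q ^ 2 * y ^ 2 ≠ 0) (h4' : c - a * q ^ 2 * (q * y) ^ 2 ≠ 0)
    (h5 : 1 - q ^ 2 * y ^ 2 ≠ 0) (h6 : 1 - b * c * q * y ^ 2 ≠ 0) :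
    ((1 - a ^ 2 * y ^ 4) * (b * c - a * q * y) * (b * c - a * q ^ 2 * y)) /
      ((1 + a * y) * (1 + a * q * y) * (b - a * q ^ 2 * y ^ 2) * (c - a * q ^ 2 * y ^ 2)) *
      termRatio (a * q ^ 2) b c q y =
    ((1 - a ^ 2 * (q * y) ^ 4) * (b * c - a * q * (q * y)) * (b * c - a * q ^ 2 * (q * y))) /
      ((1 + a * (q * y)) * (1 + a * q * (q * y)) * (b - a * q ^ 2 * (q * y) ^ 2) *
        (c - a * q ^ 2 * (q * y) ^ 2)) *
      termRatio a b c q y := by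
  have e1 : 1 - (a * q ^ 2) ^ 2 * y ^ 4 = 1 - a ^ 2 * (q * y) ^ 4 := by ring
  have e2 : b * c - a * q ^ 2 * q * y = b * c - a * q ^ 2 * (q * y) := by ring
  have e3 : 1 + a * q ^ 2 * y = 1 + a * q * (q * y) := by ring
  have e4 : b - a * q ^ 2 * q ^ 2 * y ^ 2 = b - a * q ^ 2 * (q * y) ^ 2 := by ring
  have e5 : c - a * q ^ 2 * q ^ 2 * y ^ 2 = c - a * q ^ 2 * (q * y) ^ 2 := by ring
  have e6 : 1 + a * (q * y) = 1 + a * q * y := by ring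
  have e7 : b * c - a * q * (q * y) = b * c - a * q ^ 2 * y := by ring
  unfold termRatio
  rw [e1, e2, e3, e4, e5, e6, e7]
  generalize 1 + a * y = A1 at *
  generalize 1 + a * q * y = A2 at *
  generalize 1 + a * q * (q * y) = A3 at *
  generalize b - a * q ^ 2 * y ^ 2 = A4 at *
  generalize b - a * q ^ 2 * (q * y) ^ 2 = A5 at *
  generalize c - a * q ^ 2 * y ^ 2 = A6 at *
  generalize c - a * q ^ 2 * (q * y) ^ 2 = A7 at *
  generalize 1 - q ^ 2 * y ^ 2 = A8 at *
  generalize 1 - b * c * q * y ^ 2 = A9 at *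
  clear e1 e2 e3 e4 e5 e6 e7
  field_simp

theorem a_shift_certificate {a b c q y : F}
    (h1 : 1 + a * y ≠ 0) (h2 : 1 + a * q * y ≠ 0)
    (h3 : b - a * q ^ 2 * y ^ 2 ≠ 0) (h4 : c - a * q ^ 2 * y ^ 2 ≠ 0)
    (h5 : a ^ 2 * q ^ 2 - b ^ 2 * c ^ 2 ≠ 0) :
    (1 - a * y ^ 3) * y +
      (c + a * q) * (b + a * q) / (a ^ 2 * q ^ 2 - b ^ 2 * c ^ 2) *
      (((1 - a ^ 2 * y ^ 4) * (b * c - a * q * y) * (b * c - a * q ^ 2 * y)) /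
      ((1 + a * y) * (1 + a * q * y) * (b - a * q ^ 2 * y ^ 2) * (c - a * q ^ 2 * y ^ 2))) *
        ((1 - a * q ^ 2 * y ^ 3) * y) =
     -(a * q * (b * c + a ^ 2 * q ^ 3 * y ^ 2) * (1 - a ^ 2 * y ^ 4) * (1 + q * y ^ 2) *
        (1 - b * y) * (1 - c * y) * (b * c - a * q * y)) /
       ((a ^ 2 * q ^ 2 - b ^ 2 * c ^ 2) * (1 + a * y) * (1 + a * q * y) *
        (b - a * q ^ 2 * y ^ 2) * (c - a * q ^ 2 * y ^ 2)) -
     -(a * (1 - y ^ 2) * (q - b * c * y ^ 2) * (b * c + a ^ 2 * q * y ^ 2)) /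
       ((a ^ 2 * q ^ 2 - b ^ 2 * c ^ 2) * (1 + a * y)) := by
  have key : (1 - a * y ^ 3) * y * ((a ^ 2 * q ^ 2 - b ^ 2 * c ^ 2) * (1 + a * y) *
        (1 + a * q * y) * (b - a * q ^ 2 * y ^ 2) * (c - a * q ^ 2 * y ^ 2)) +
      (c + a * q) * (b + a * q) * ((1 - a ^ 2 * y ^ 4) * (b * c - a * q * y) *
        (b * c - a * q ^ 2 * y)) * ((1 - a * q ^ 2 * y ^ 3) * y) =
      -(a * q * (b * c + a ^ 2 * q ^ 3 * y ^ 2) * (1 - a ^ 2 * y ^ 4) * (1 + q * y ^ 2) *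
        (1 - b * y) * (1 - c * y) * (b * c - a * q * y)) +
      a * (1 - y ^ 2) * (q - b * c * y ^ 2) * (b * c + a ^ 2 * q * y ^ 2) *
       ((1 + a * q * y) * (b - a * q ^ 2 * y ^ 2) * (c - a * q ^ 2 * y ^ 2)) := by ring
  generalize 1 + a * y = A1 at *
  generalize 1 + a * q * y = A2 at *
  generalize b - a * q ^ 2 * y ^ 2 = A4 at *
  generalize c - a * q ^ 2 * y ^ 2 = A6 at *
  generalize a ^ 2 * q ^ 2 - b ^ 2 * c ^ 2 = A7 at *
  generalize (1 - a ^ 2 * y ^ 4) * (b * c - a * q * y) * (b * c - a * q ^ 2 * y) = B1 at *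
  generalize a * q * (b * c + a ^ 2 * q ^ 3 * y ^ 2) * (1 - a ^ 2 * y ^ 4) * (1 + q * y ^ 2) *
        (1 - b * y) * (1 - c * y) * (b * c - a * q * y) = B2 at *
  generalize a * (1 - y ^ 2) * (q - b * c * y ^ 2) * (b * c + a ^ 2 * q * y ^ 2) = B3 at *
  generalize (c + a * q) * (b + a * q) = B4 at *
  generalize (1 - a * q ^ 2 * y ^ 3) * y = B5 at *
  generalize (1 - a * y ^ 3) * y = B6 at *
  field_simp
  linear_combination key

theorem a_shift_boundary {a b c q y : F}
    (h1 : 1 + a * y ≠ 0) (h2 : 1 + a * q * y ≠ 0)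
    (h3 : b - a * q ^ 2 * y ^ 2 ≠ 0) (h4 : c - a * q ^ 2 * y ^ 2 ≠ 0)
    (h5 : a ^ 2 * q ^ 2 - b ^ 2 * c ^ 2 ≠ 0)
    (h6 : 1 - q ^ 2 * y ^ 2 ≠ 0) (h7 : 1 - b * c * q * y ^ 2 ≠ 0) :
     -(a * (1 - (q * y) ^ 2) * (q - b * c * (q * y) ^ 2) * (b * c + a ^ 2 * q * (q * y) ^ 2)) /
       ((a ^ 2 * q ^ 2 - b ^ 2 * c ^ 2) * (1 + a * (q * y))) * termRatio a b c q y =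
     -(a * q * (b * c + a ^ 2 * q ^ 3 * y ^ 2) * (1 - a ^ 2 * y ^ 4) * (1 + q * y ^ 2) *
        (1 - b * y) * (1 - c * y) * (b * c - a * q * y)) /
       ((a ^ 2 * q ^ 2 - b ^ 2 * c ^ 2) * (1 + a * y) * (1 + a * q * y) *
        (b - a * q ^ 2 * y ^ 2) * (c - a * q ^ 2 * y ^ 2)) := by
  have e1 : 1 - (q * y) ^ 2 = 1 - q ^ 2 * y ^ 2 := by ring
  have e2 : q - b * c * (q * y) ^ 2 = q * (1 - b * c * q * y ^ 2) := by ring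
  have e3 : a ^ 2 * q * (q * y) ^ 2 = a ^ 2 * q ^ 3 * y ^ 2 := by ring
  have e6 : 1 + a * (q * y) = 1 + a * q * y := by ring
  unfold termRatio
  rw [e1, e2, e3, e6]
  generalize 1 + a * y = A1 at *
  generalize 1 + a * q * y = A2 at *
  generalize b - a * q ^ 2 * y ^ 2 = A4 at *
  generalize c - a * q ^ 2 * y ^ 2 = A6 at *
  generalize a ^ 2 * q ^ 2 - b ^ 2 * c ^ 2 = A7 at *
  generalize 1 - q ^ 2 * y ^ 2 = A8 at *
  generalize 1 - b * c * q * y ^ 2 = A9 at *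
  clear e1 e2 e3 e6
  field_simp

theorem termProd_eq_zero {a b c q : F} {j k : ℕ} (hjk : j < k)
    (h : termRatio a b c q (q ^ j) = 0) : termProd a b c q k = 0 :=
  prod_eq_zero (mem_range.2 hjk) h

/-- Contiguous relation shifting `b` to `b * q ^ 2`. -/
theorem sum_qTerm_b_shift {a b c q : F} {M : ℕ} (hq : q ≠ 0) (hbM : b * q ^ M = 1)
    (h1 : ∀ k : ℕ, b * c * q - a * q ^ k ≠ 0) (h3 : ∀ k : ℕ, 1 - b * c * q * (q ^ k) ^ 2 ≠ 0)
    (h5 : ∀ k : ℕ, 1 - q ^ 2 * (q ^ k) ^ 2 ≠ 0) (h6 : ∀ k : ℕ, 1 + a * q ^ k ≠ 0)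
    (h7 : ∀ k : ℕ, b - a * (q ^ k) ^ 2 ≠ 0) (h8 : ∀ k : ℕ, c - a * q ^ 2 * (q ^ k) ^ 2 ≠ 0)
    (h9 : b ^ 2 - 1 ≠ 0) (h10 : b * q + a ≠ 0) :
    ∃ l, ∑ k ∈ range (M + 1), qTerm a b c q k =
      l * ∑ k ∈ range (M + 1), qTerm a (b * q ^ 2) c q k := by
  have h2 (k : ℕ) : b * c - a * q ^ k ≠ 0 := by
    intro h
    apply h1 (k + 1)
    rw [pow_succ]
    linear_combination q * h
  set κ := -((b * c * q + a) * (b * c + 1) * (b * c * q - a) / ((b ^ 2 - 1) * (b * q + a)))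
  let ρ : ℕ → F := fun k ↦ ((1 - b * q ^ k) * (1 - b * q * q ^ k) * (b - a * (q ^ k) ^ 2)) /
        ((b * c * q - a * q ^ k) * (b * c - a * q ^ k) * (1 - b * c * q * (q ^ k) ^ 2))
  have hρ (k : ℕ) : ρ 0 * termProd a (b * q ^ 2) c q k = ρ k * termProd a b c q k := by
    refine mul_prod_eq_mul_prod ρ (fun j ↦ termRatio a b c q (q ^ j)) _ k (fun j _ ↦ ?_) k le_rfl
    have := termRatio_b_shift (h1 j) (h2 j) (h3 j) (by simpa [pow_succ'] using h3 (j + 1))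
      (by simpa [pow_succ'] using h2 (j + 1)) (h5 j) (h6 j)
      (by simpa [pow_succ'] using h7 (j + 1)) (h7 j) (h8 j) hq
    simpa [ρ, pow_succ'] using this
  refine ⟨κ * ρ 0, sub_eq_zero.1 ?_⟩
  rw [sum_sub_mul_sum_eq (qTerm a b c q) (qTerm a (b * q ^ 2) c q)
    (fun k ↦ (a - b ^ 2 * c * q) * b * (1 - (q ^ k) ^ 2) * (q + a * q ^ k) * (b - a * (q ^ k) ^ 2) *
        (c - a * (q ^ k) ^ 2) /
       ((b ^ 2 - 1) * (b * q + a) * (b * c - a * q ^ k) * (b * c * q - a * q ^ k)) *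
       termProd a b c q k)
    (fun k ↦ (a - b ^ 2 * c * q) * b * (1 - a ^ 2 * (q ^ k) ^ 4) * (1 + q * (q ^ k) ^ 2) *
        (1 - b * q ^ k) * (1 - c * q ^ k) /
       ((b ^ 2 - 1) * (b * q + a) * (b * c - a * q ^ k) * (1 - b * c * q * (q ^ k) ^ 2)) *
       termProd a b c q k) (κ * ρ 0) M (by simp)]
  · simp [hbM]
  · intro k _
    have := b_shift_certificate (h1 k) (h2 k) (h3 k) h9 h10
    unfold qTerm
    linear_combination termProd a b c q k * this - κ * ((1 - a * (q ^ k) ^ 3) * q ^ k) * hρ k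
  · intro k _
    have := b_shift_boundary (h2 k) (h3 k) (by simpa [pow_succ'] using h2 (k + 1)) (h5 k) (h6 k)
      (by simpa [pow_succ'] using h7 (k + 1)) (h8 k) hq h9 h10
    simp only [← this, pow_succ' q k, termProd, prod_range_succ]
    ring

/-- Contiguous relation shifting `a` to `a * q ^ 2`. -/
theorem sum_qTerm_a_shift {a b c q : F} {M : ℕ} (haM : a * q ^ (2 * M) = 1)
    (h1 : ∀ k : ℕ, 1 + a * q ^ k ≠ 0)
    (h3 : ∀ k : ℕ, b - a * q ^ 2 * (q ^ k) ^ 2 ≠ 0) (h4 : ∀ k : ℕ, c - a * q ^ 2 * (q ^ k) ^ 2 ≠ 0)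
    (h5 : a ^ 2 * q ^ 2 - b ^ 2 * c ^ 2 ≠ 0)
    (h6 : ∀ k < M, 1 - q ^ 2 * (q ^ k) ^ 2 ≠ 0) (h7 : ∀ k < M, 1 - b * c * q * (q ^ k) ^ 2 ≠ 0) :
    ∃ l, ∑ k ∈ range (M + 1), qTerm a b c q k =
      l * ∑ k ∈ range (M + 1), qTerm (a * q ^ 2) b c q k := by
  have h2 (k : ℕ) : 1 + a * q * q ^ k ≠ 0 := by
    simpa [pow_succ', mul_assoc] using h1 (k + 1)
  set κ := -((c + a * q) * (b + a * q) / (a ^ 2 * q ^ 2 - b ^ 2 * c ^ 2))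
  let ρ : ℕ → F := fun k ↦
    ((1 - a ^ 2 * (q ^ k) ^ 4) * (b * c - a * q * q ^ k) * (b * c - a * q ^ 2 * q ^ k)) /
      ((1 + a * q ^ k) * (1 + a * q * q ^ k) * (b - a * q ^ 2 * (q ^ k) ^ 2) *
        (c - a * q ^ 2 * (q ^ k) ^ 2))
  have hρ (k : ℕ) (hk : k ≤ M) :
      ρ 0 * termProd (a * q ^ 2) b c q k = ρ k * termProd a b c q k := by
    refine mul_prod_eq_mul_prod ρ (fun j ↦ termRatio a b c q (q ^ j)) _ M (fun j hj ↦ ?_) k hk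
    have := termRatio_a_shift (h1 j) (h2 j) (by simpa [pow_succ'] using h2 (j + 1)) (h3 j)
      (by simpa [pow_succ'] using h3 (j + 1)) (h4 j) (by simpa [pow_succ'] using h4 (j + 1))
      (h6 j hj) (h7 j hj)
    simpa only [ρ, pow_succ'] using this
  refine ⟨κ * ρ 0, sub_eq_zero.1 ?_⟩
  rw [sum_sub_mul_sum_eq (qTerm a b c q) (qTerm (a * q ^ 2) b c q)
    (fun k ↦ -(a * (1 - (q ^ k) ^ 2) * (q - b * c * (q ^ k) ^ 2) *
        (b * c + a ^ 2 * q * (q ^ k) ^ 2)) /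
       ((a ^ 2 * q ^ 2 - b ^ 2 * c ^ 2) * (1 + a * q ^ k)) * termProd a b c q k)
    (fun k ↦ -(a * q * (b * c + a ^ 2 * q ^ 3 * (q ^ k) ^ 2) * (1 - a ^ 2 * (q ^ k) ^ 4) *
        (1 + q * (q ^ k) ^ 2) * (1 - b * q ^ k) * (1 - c * q ^ k) * (b * c - a * q * q ^ k)) /
       ((a ^ 2 * q ^ 2 - b ^ 2 * c ^ 2) * (1 + a * q ^ k) * (1 + a * q * q ^ k) *
        (b - a * q ^ 2 * (q ^ k) ^ 2) * (c - a * q ^ 2 * (q ^ k) ^ 2)) * termProd a b c q k)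
    (κ * ρ 0) M (by simp)]
  · have : 1 - a ^ 2 * (q ^ M) ^ 4 = 0 := by
      linear_combination (-1 - a * q ^ (2 * M)) * haM
    simp [this]
  · intro k hk
    have := a_shift_certificate (h1 k) (h2 k) (h3 k) (h4 k) h5
    unfold qTerm
    linear_combination termProd a b c q k * this -
      κ * ((1 - a * q ^ 2 * (q ^ k) ^ 3) * q ^ k) * hρ k hk
  · intro k hk
    have := a_shift_boundary (h1 k) (h2 k) (h3 k) (h4 k) h5 (h6 k hk) (h7 k hk)
    simp only [← this, pow_succ' q k, termProd, prod_range_succ]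
    ring

theorem sum_qTerm_eq_zero_of_b_eq {a c q : F} (m : ℕ) (hq : q ≠ 0)
    (hroot : ∀ k : ℕ, k ≠ 0 → q ^ k ≠ 1) (ha : ∀ k : ℕ, 1 + a * q ^ k ≠ 0)
    (ha' : ∀ k : ℕ, 1 - a * q ^ k ≠ 0) (hca : ∀ k : ℕ, c - a * q ^ k ≠ 0)
    (hc : ∀ k : ℕ, q ^ (2 * m) - c * q ^ (2 * k) ≠ 0) :
    ∑ k ∈ range (2 * m + 2), qTerm a (q ^ (2 * m + 1))⁻¹ c q k = 0 := by
  induction m with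
  | zero =>
    have h1 : 1 - q ≠ 0 := sub_ne_zero.2 (by simpa using (hroot 1 one_ne_zero).symm)
    have h2 : 1 + q ≠ 0 := by
      intro h
      apply hroot 2 two_ne_zero
      linear_combination (q - 1) * h
    have h3 : 1 + a ≠ 0 := by simpa using ha 0
    have h4 : 1 - a * q ^ 3 ≠ 0 := ha' 3
    have h5 : c - a * q ^ 2 ≠ 0 := hca 2
    have h6 : 1 - c ≠ 0 := by simpa using hc 0
    have e1 : q⁻¹ - a * q ^ 2 = q⁻¹ * (1 - a * q ^ 3) := by field_simp
    have e2 : q⁻¹ * c - a * q = q⁻¹ * (c - a * q ^ 2) := by field_simp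
    have e3 : 1 - q ^ 2 = (1 - q) * (1 + q) := by ring
    have e4 : 1 - a ^ 2 = (1 - a) * (1 + a) := by ring
    have e5 : 1 - q⁻¹ * c * q = 1 - c := by field_simp
    simp only [mul_zero, zero_add, sum_range_succ, sum_range_zero, qTerm, termProd, termRatio,
      prod_range_succ, prod_range_zero, pow_zero, pow_one, one_pow, mul_one, one_mul]
    rw [e1, e2, e3, e4, e5]
    generalize 1 - a * q ^ 3 = A1 at *
    generalize c - a * q ^ 2 = A2 at *
    generalize 1 - c = A3 at *
    generalize 1 + q = A4 at *
    generalize 1 + a = A5 at *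
    clear e1 e2 e3 e4 e5
    field_simp
    ring
  | succ m ih =>
    have hb : (q ^ (2 * (m + 1) + 1))⁻¹ * q ^ 2 = (q ^ (2 * m + 1))⁻¹ := by
      field_simp
      ring
    have hB : (q ^ (2 * (m + 1) + 1))⁻¹ * q ^ (2 * (m + 1) + 1) = 1 :=
      inv_mul_cancel₀ (by simp [hq])
    have ih := ih fun k h ↦ hc (k + 1) (by linear_combination q ^ 2 * h)
    have key := sum_qTerm_b_shift (a := a) (c := c) (M := 2 * (m + 1) + 1) hq hB
      (fun k h ↦ hca (k + 2 * (m + 1)) ?_) (fun k h ↦ hc k ?_)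
      (fun k h ↦ hroot (2 * k + 2) (by omega) (by linear_combination -h)) ha
      (fun k h ↦ ha' (2 * k + (2 * (m + 1) + 1)) ?_)
      (fun k h ↦ hca (2 * k + 2) (by linear_combination h))
      (fun h ↦ hroot (2 * (2 * (m + 1) + 1)) (by omega) ?_) (fun h ↦ ha (2 * (m + 1)) ?_)
    · obtain ⟨l, hl⟩ := key
      rw [show 2 * (m + 1) + 2 = 2 * (m + 1) + 1 + 1 by ring, hl, hb,
        show 2 * (m + 1) + 1 + 1 = 2 * m + 2 + 1 + 1 by ring, sum_range_succ, sum_range_succ, ih]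
      have hz : termRatio a (q ^ (2 * m + 1))⁻¹ c q (q ^ (2 * m + 1)) = 0 := by
        simp [termRatio, hq]
      simp [qTerm, termProd_eq_zero (show 2 * m + 1 < 2 * m + 2 by omega) hz,
        termProd_eq_zero (show 2 * m + 1 < 2 * m + 2 + 1 by omega) hz]
    · linear_combination q ^ (2 * (m + 1)) * h - c * hB
    · linear_combination q ^ (2 * (m + 1)) * h + c * q ^ (2 * k) * hB
    · linear_combination q ^ (2 * (m + 1) + 1) * h - hB
    · linear_combination -(q ^ (2 * (m + 1) + 1)) ^ 2 * h +
        ((q ^ (2 * (m + 1) + 1))⁻¹ * q ^ (2 * (m + 1) + 1) + 1) * hB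
    · linear_combination q ^ (2 * (m + 1)) * h - hB

theorem sum_qTerm_eq_zero_of_a_eq {b c q : F} (M : ℕ) (hq : q ≠ 0)
    (hneg : ∀ j k : ℕ, q ^ j + q ^ k ≠ 0) (hb : ∀ j k : ℕ, b * q ^ j - q ^ k ≠ 0)
    (hc : ∀ j k : ℕ, c * q ^ j - q ^ k ≠ 0) (hroot : ∀ k < M, 1 - q ^ 2 * (q ^ k) ^ 2 ≠ 0)
    (hbc : ∀ k < M, 1 - b * c * q * (q ^ k) ^ 2 ≠ 0)
    (hbc' : ∀ k < M, 1 + b * c * q * (q ^ k) ^ 2 ≠ 0) :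
    ∑ k ∈ range (M + 1), qTerm (q ^ (2 * M))⁻¹ b c q k = 0 := by
  induction M with
  | zero => simp [qTerm]
  | succ M ih =>
    have hA : (q ^ (2 * (M + 1)))⁻¹ * q ^ 2 = (q ^ (2 * M))⁻¹ := by
      field_simp
      ring
    have hA0 : q ^ (2 * (M + 1)) ≠ 0 := by simp [hq]
    have hA1 := inv_mul_cancel₀ hA0
    have ih := ih (fun k hk ↦ hroot k (by omega)) (fun k hk ↦ hbc k (by omega))
      (fun k hk ↦ hbc' k (by omega))
    have key := sum_qTerm_a_shift (b := b) (c := c) (inv_mul_cancel₀ hA0)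
      (fun k h ↦ hneg (2 * (M + 1)) k ?_) (fun k h ↦ hb (2 * (M + 1)) (2 * k + 2) ?_)
      (fun k h ↦ hc (2 * (M + 1)) (2 * k + 2) ?_) ?_ hroot hbc
    · obtain ⟨l, hl⟩ := key
      rw [hl, hA, sum_range_succ, ih]
      have hz : termRatio (q ^ (2 * M))⁻¹ b c q (q ^ M) = 0 := by
        have : 1 - ((q ^ (2 * M))⁻¹) ^ 2 * (q ^ M) ^ 4 = 0 := by
          field_simp
          ring
        rw [termRatio, this]
        simp
      simp [qTerm, termProd_eq_zero (show M < M + 1 by omega) hz]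
    · linear_combination q ^ (2 * (M + 1)) * h - q ^ k * hA1
    · linear_combination q ^ (2 * (M + 1)) * h + q ^ (2 * k + 2) * hA1
    · linear_combination q ^ (2 * (M + 1)) * h + q ^ (2 * k + 2) * hA1
    · intro h
      refine mul_ne_zero (hbc M (by omega)) (hbc' M (by omega)) ?_
      generalize (q ^ (2 * (M + 1)))⁻¹ = A at *
      linear_combination q ^ (4 * M + 2) * h - (A * q ^ (2 * (M + 1)) + 1) * hA1

end Quadratic

section Cleared

variable {R : Type*} [CommRing R]

/-- Numerator of the term ratio for `a = q`, `b = q * x`, `c = q / x`, base `q ^ d`,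
where `z = x + 1 / x`. -/
def numFactor (d : ℕ) (q z y : R) : R :=
  (1 - q ^ 2 * y ^ 4) * (1 + q ^ d * y ^ 2) * (1 + q ^ 2 * y ^ 2 - q * y * z) *
    (1 - q ^ (d - 1) * y)

/-- Denominator of the term ratio for `a = q`, `b = q * x`, `c = q / x`, base `q ^ d`,
where `z = x + 1 / x`. -/
def denFactor (d : ℕ) (q z y : R) : R :=
  (1 - (q ^ d) ^ 2 * y ^ 2) * (1 + q * y) *
    (1 + ((q ^ d) ^ 2 * y ^ 2) ^ 2 - (q ^ d) ^ 2 * y ^ 2 * z) * (1 - q ^ (d + 2) * y ^ 2)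

/-- The truncated sum for `a = q`, `b = q * x`, `c = q / x`, base `q ^ d`, multiplied by the common
denominator `∏ j < M, denFactor`; it is a polynomial in `q` and `z = x + 1 / x`. -/
def clearedSum (d : ℕ) (q z : R) (M : ℕ) : R :=
  ∑ k ∈ range (M + 1), (1 - q * ((q ^ d) ^ k) ^ 3) * (q ^ d) ^ k *
    ((∏ j ∈ range k, numFactor d q z ((q ^ d) ^ j)) *
      ∏ j ∈ Ico k M, denFactor d q z ((q ^ d) ^ j))

theorem map_numFactor {S : Type*} [CommRing S] (φ : R →+* S) (d : ℕ) (q z y : R) :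
    φ (numFactor d q z y) = numFactor d (φ q) (φ z) (φ y) := by
  simp [numFactor]

theorem map_denFactor {S : Type*} [CommRing S] (φ : R →+* S) (d : ℕ) (q z y : R) :
    φ (denFactor d q z y) = denFactor d (φ q) (φ z) (φ y) := by
  simp [denFactor]

theorem map_clearedSum {S : Type*} [CommRing S] (φ : R →+* S) (d : ℕ) (q z : R) (M : ℕ) :
    φ (clearedSum d q z M) = clearedSum d (φ q) (φ z) M := by
  simp [clearedSum, map_numFactor, map_denFactor]

variable {F : Type*} [Field F]

theorem clearedSum_eq {d : ℕ} {q z : F} {M : ℕ}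
    (hden : ∀ j < M, denFactor d q z ((q ^ d) ^ j) ≠ 0) :
    clearedSum d q z M = (∏ j ∈ range M, denFactor d q z ((q ^ d) ^ j)) *
      ∑ k ∈ range (M + 1), (1 - q * ((q ^ d) ^ k) ^ 3) * (q ^ d) ^ k *
        ∏ j ∈ range k, numFactor d q z ((q ^ d) ^ j) / denFactor d q z ((q ^ d) ^ j) := by
  rw [clearedSum, mul_sum]
  refine sum_congr rfl fun k hk ↦ ?_
  have hkM : k ≤ M := by simpa [Nat.lt_succ_iff] using hk
  have h0 : ∏ j ∈ range k, denFactor d q z ((q ^ d) ^ j) ≠ 0 :=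
    prod_ne_zero_iff.2 fun j hj ↦ hden j ((mem_range.1 hj).trans_le hkM)
  rw [prod_div_distrib, ← prod_range_mul_prod_Ico _ hkM]
  field_simp

theorem termRatio_eq_div {d : ℕ} (hd : d ≠ 0) {q x y : F} (hq : q ≠ 0) (hx : x ≠ 0) :
    termRatio q (q * x) (q * x⁻¹) (q ^ d) y =
      numFactor d q (x + x⁻¹) y / denFactor d q (x + x⁻¹) y := by
  obtain ⟨d, rfl⟩ := Nat.exists_eq_succ_of_ne_zero hd
  have hq2 : q ^ 2 ≠ 0 := pow_ne_zero 2 hq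
  have hxx : x * x⁻¹ = 1 := mul_inv_cancel₀ hx
  rw [termRatio, ← mul_div_mul_left (numFactor _ _ _ _) _ hq2]
  generalize x⁻¹ = w at *
  congr 1
  · simp only [numFactor, Nat.succ_eq_add_one, Nat.add_sub_cancel]
    linear_combination ((1 - q ^ 2 * y ^ 4) * (1 + q ^ (d + 1) * y ^ 2) *
      (q ^ 2 * y ^ 2 * (q * x * (q * w) - q * q ^ (d + 1) * y) +
        q ^ 2 * (1 + q ^ 2 * y ^ 2 - q * y * (x + w)))) * hxx
  · simp only [denFactor, Nat.succ_eq_add_one]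
    linear_combination ((1 - (q ^ (d + 1)) ^ 2 * y ^ 2) * (1 + q * y) *
      (q ^ 2 * (1 - q * x * (q * w) * q ^ (d + 1) * y ^ 2) -
        q ^ 2 * (1 + ((q ^ (d + 1)) ^ 2 * y ^ 2) ^ 2 - (q ^ (d + 1)) ^ 2 * y ^ 2 * (x + w)) *
          q ^ 2 * q ^ (d + 1) * y ^ 2)) * hxx

theorem clearedSum_eq_mul_sum_qTerm {d : ℕ} (hd : d ≠ 0) {q x : F} {M : ℕ} (hq : q ≠ 0)
    (hx : x ≠ 0) (hden : ∀ j < M, denFactor d q (x + x⁻¹) ((q ^ d) ^ j) ≠ 0) :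
    clearedSum d q (x + x⁻¹) M = (∏ j ∈ range M, denFactor d q (x + x⁻¹) ((q ^ d) ^ j)) *
      ∑ k ∈ range (M + 1), qTerm q (q * x) (q * x⁻¹) (q ^ d) k := by
  rw [clearedSum_eq hden]
  simp only [qTerm, termProd, termRatio_eq_div hd hq hx]

theorem clearedSum_pow_eq_zero {d n t M : ℕ} (hd : 2 ≤ d) (hde : Even d)
    (hn : n = d * (2 * t + 1) + 1) (hM : 2 * M = n + 2 * t + 1) {q : F} (hq : q ≠ 0)
    (hinj : ∀ i j : ℕ, i ≠ j → q ^ i - q ^ j ≠ 0) (hneg : ∀ i j : ℕ, q ^ i + q ^ j ≠ 0) :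
    clearedSum d q ((q ^ n)⁻¹ + (q ^ n)⁻¹⁻¹) M = 0 := by
  have hu : q ^ n ≠ 0 := pow_ne_zero n hq
  have hdt : 2 * (2 * t + 1) ≤ d * (2 * t + 1) := Nat.mul_le_mul_right _ hd
  have hodd (j : ℕ) : n ≠ 2 * d * (j + 1) := by
    obtain ⟨e, rfl⟩ := hde
    rw [hn, ← two_mul, mul_assoc, mul_assoc]
    omega
  rw [clearedSum_eq_mul_sum_qTerm (by omega) hq (inv_ne_zero hu), inv_inv]
  · have hb : q * (q ^ n)⁻¹ = ((q ^ d) ^ (2 * t + 1))⁻¹ := by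
      rw [hn]
      field_simp
      ring
    rw [hb]
    have key := sum_qTerm_eq_zero_of_b_eq (a := q) (c := q * q ^ n) (q := q ^ d) t
      (pow_ne_zero d hq)
      (fun k hk h ↦ hinj (d * k) 0 (by positivity) (by linear_combination h))
      (fun k h ↦ hneg 0 (d * k + 1) (by linear_combination h))
      (fun k h ↦ hinj 0 (d * k + 1) (by omega) (by linear_combination h))
      (fun k h ↦ hinj (n + 1) (d * k + 1) ?_ (by linear_combination h))
      (fun k h ↦ hinj (d * (2 * t)) (n + 1 + d * (2 * k)) ?_ (by linear_combination h))
    · have hz : termRatio q ((q ^ d) ^ (2 * t + 1))⁻¹ (q * q ^ n) (q ^ d)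
          ((q ^ d) ^ (2 * t + 1)) = 0 := by
        have h : ((q ^ d) ^ (2 * t + 1))⁻¹ * (q ^ d) ^ (2 * t + 1) = 1 :=
          inv_mul_cancel₀ (pow_ne_zero _ (pow_ne_zero _ hq))
        rw [termRatio, h]
        simp
      rw [← sum_range_add_sum_Ico _ (show 2 * t + 2 ≤ M + 1 by omega), key, zero_add,
        sum_eq_zero, mul_zero]
      intro k hk
      rw [qTerm, termProd_eq_zero (j := 2 * t + 1) _ hz, mul_zero]
      have := (mem_Ico.1 hk).1
      omega
    · rw [hn]
      intro h
      have h1 : d * k = d * (2 * t + 1) + 1 := by omega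
      have h2 : d ∣ 1 :=
        (Nat.dvd_add_right (dvd_mul_right d (2 * t + 1))).1 (h1 ▸ dvd_mul_right d k)
      have := Nat.le_of_dvd one_pos h2
      omega
    · rw [hn]
      have : d * (2 * t + 1) = d * (2 * t) + d := by ring
      omega
  · intro j _
    refine mul_ne_zero (mul_ne_zero (mul_ne_zero ?_ ?_) ?_) ?_
    · intro h
      exact hinj 0 (2 * d * (j + 1)) (by positivity) (by linear_combination h)
    · intro h
      exact hneg 0 (d * j + 1) (by linear_combination h)
    · intro h
      have h1 : q ^ n * (q ^ n)⁻¹ = 1 := mul_inv_cancel₀ hu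
      rw [inv_inv] at h
      refine mul_ne_zero (hinj n (2 * d * (j + 1)) (hodd j))
        (hinj 0 (n + 2 * d * (j + 1)) (by omega)) ?_
      linear_combination q ^ n * h + (q ^ d) ^ 2 * ((q ^ d) ^ j) ^ 2 * h1
    · intro h
      exact hinj 0 (d + 2 + 2 * d * j) (by omega) (by linear_combination h)

end Cleared

section RootsOfUnity

theorem coprime_two_mul_of_eq {d n t : ℕ} (hde : Even d) (hn : n = d * (2 * t + 1) + 1) :
    n.Coprime (2 * d) := by
  have hd : n.Coprime d := by simp [hn]
  refine Nat.Coprime.mul_right ?_ hd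
  rw [Nat.coprime_two_right, hn]
  exact (hde.mul_right _).add_one

theorem not_dvd_two_mul_mul_succ {d n t M j : ℕ} (hd : 2 ≤ d) (hde : Even d)
    (hn : n = d * (2 * t + 1) + 1) (hM : 2 * M = n + 2 * t + 1) (hj : j < M) :
    ¬n ∣ 2 * d * (j + 1) := by
  intro h
  have h1 := Nat.le_of_dvd (by omega) ((coprime_two_mul_of_eq hde hn).dvd_of_dvd_mul_left h)
  have hdt : 2 * (2 * t + 1) ≤ d * (2 * t + 1) := Nat.mul_le_mul_right _ hd
  omega

theorem not_dvd_add_two_add_two_mul {d n t M j : ℕ} (hd : 2 ≤ d) (hde : Even d)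
    (hn : n = d * (2 * t + 1) + 1) (hM : 2 * M = n + 2 * t + 1) (hj : j < M) :
    ¬n ∣ d + 2 + 2 * d * j := by
  intro h
  obtain ⟨i, rfl⟩ := Nat.exists_eq_add_of_lt hj
  have e : d + 2 + 2 * d * j + 2 * d * (i + 1 + t) = n * (d + 2) := by
    have h1 : d * (2 * (j + i + 1)) = d * (n + 2 * t + 1) := by rw [hM]
    rw [hn] at h1 ⊢
    linear_combination h1
  have h2 : n ∣ 2 * d * (i + 1 + t) := (Nat.dvd_add_right h).1 (e ▸ dvd_mul_right n _)
  have h3 := Nat.le_of_dvd (by omega) ((coprime_two_mul_of_eq hde hn).dvd_of_dvd_mul_left h2)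
  have hdt : 2 * (2 * t + 1) ≤ d * (2 * t + 1) := Nat.mul_le_mul_right _ hd
  omega

theorem pow_add_pow_ne_zero_of_pow_eq_one {K : Type*} [Field K] [CharZero K] {ζ : K} {n : ℕ}
    (hn : Odd n) (hζ : ζ ^ n = 1) (i j : ℕ) : ζ ^ i + ζ ^ j ≠ 0 := by
  intro h
  have h1 : (ζ ^ i) ^ n = (-ζ ^ j) ^ n := by rw [eq_neg_of_add_eq_zero_left h]
  rw [hn.neg_pow, pow_right_comm, pow_right_comm ζ j, hζ, one_pow, one_pow] at h1
  norm_num at h1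

theorem denFactor_ne_zero_of_isPrimitiveRoot {d n t M j : ℕ} (hd : 2 ≤ d) (hde : Even d)
    (hn : n = d * (2 * t + 1) + 1) (hM : 2 * M = n + 2 * t + 1) (hj : j < M) {K : Type*} [Field K]
    [CharZero K] {ζ z : K} (hζ : IsPrimitiveRoot ζ n)
    (hz : 1 + ((ζ ^ d) ^ 2 * ((ζ ^ d) ^ j) ^ 2) ^ 2 - (ζ ^ d) ^ 2 * ((ζ ^ d) ^ j) ^ 2 * z ≠ 0) :
    denFactor d ζ z ((ζ ^ d) ^ j) ≠ 0 := by
  have hodd : Odd n := Nat.coprime_two_right.1 (coprime_two_mul_of_eq hde hn).coprime_mul_right_right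
  refine mul_ne_zero (mul_ne_zero (mul_ne_zero ?_ ?_) hz) ?_
  · intro h
    refine not_dvd_two_mul_mul_succ hd hde hn hM hj ((hζ.pow_eq_one_iff_dvd _).1 ?_)
    linear_combination -h
  · intro h
    exact pow_add_pow_ne_zero_of_pow_eq_one hodd hζ.pow_eq_one 0 (d * j + 1)
      (by linear_combination h)
  · intro h
    refine not_dvd_add_two_add_two_mul hd hde hn hM hj ((hζ.pow_eq_one_iff_dvd _).1 ?_)
    linear_combination -h

theorem clearedSum_eq_zero_of_isPrimitiveRoot {d n t M : ℕ} (hd : 2 ≤ d) (hde : Even d)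
    (hn : n = d * (2 * t + 1) + 1) (hM : 2 * M = n + 2 * t + 1) {ζ x : ℂ}
    (hζ : IsPrimitiveRoot ζ n) (hx : 1 < ‖x‖) : clearedSum d ζ (x + x⁻¹) M = 0 := by
  have hn0 : n ≠ 0 := by omega
  have hodd : Odd n := Nat.coprime_two_right.1 (coprime_two_mul_of_eq hde hn).coprime_mul_right_right
  have hneg := pow_add_pow_ne_zero_of_pow_eq_one hodd hζ.pow_eq_one
  have hζ0 : ζ ≠ 0 := hζ.ne_zero hn0
  have hnorm : ‖ζ‖ = 1 := hζ.norm'_eq_one hn0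
  have hx0 : x ≠ 0 := norm_pos_iff.1 (by linarith)
  have hxx : x * x⁻¹ = 1 := mul_inv_cancel₀ hx0
  have hx1 (i j : ℕ) : ζ ^ i * x ≠ ζ ^ j := by
    intro h
    have := congrArg norm h
    simp only [norm_mul, norm_pow, hnorm, one_pow, one_mul] at this
    linarith
  have hx2 (i j : ℕ) : ζ ^ i * x⁻¹ ≠ ζ ^ j := by
    intro h
    refine hx1 j i ?_
    linear_combination -x * h + ζ ^ i * hxx
  have hbc : ζ * x * (ζ * x⁻¹) = ζ ^ 2 := by linear_combination ζ ^ 2 * hxx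
  rw [clearedSum_eq_mul_sum_qTerm (by omega) hζ0 hx0]
  · have key := sum_qTerm_eq_zero_of_a_eq (b := ζ * x) (c := ζ * x⁻¹) (q := ζ ^ d) M
      (pow_ne_zero d hζ0)
      (fun j k h ↦ hneg (d * j) (d * k) (by linear_combination h))
      (fun j k h ↦ hx1 (d * j + 1) (d * k) (by linear_combination h))
      (fun j k h ↦ hx2 (d * j + 1) (d * k) (by linear_combination h))
      (fun k hk h ↦ not_dvd_two_mul_mul_succ hd hde hn hM hk
        ((hζ.pow_eq_one_iff_dvd _).1 (by linear_combination -h)))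
      (fun k hk h ↦ not_dvd_add_two_add_two_mul hd hde hn hM hk
        ((hζ.pow_eq_one_iff_dvd _).1
          (by linear_combination -h - ζ ^ d * ((ζ ^ d) ^ k) ^ 2 * hbc)))
      (fun k _ h ↦ hneg 0 (d + 2 + 2 * d * k)
        (by linear_combination h - ζ ^ d * ((ζ ^ d) ^ k) ^ 2 * hbc))
    have ha : ((ζ ^ d) ^ (2 * M))⁻¹ = ζ := by
      apply inv_eq_of_mul_eq_one_left
      have e : 1 + d * (2 * M) = n * (d + 1) := by
        rw [hM, hn]
        ring
      rw [← pow_mul, ← pow_succ', add_comm, e, pow_mul, hζ.pow_eq_one, one_pow]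
    rw [ha] at key
    rw [key, mul_zero]
  · intro j hj
    refine denFactor_ne_zero_of_isPrimitiveRoot hd hde hn hM hj hζ fun h ↦ ?_
    have h1 : (1 - ζ ^ (2 * d * (j + 1)) * x) * (1 - ζ ^ (2 * d * (j + 1)) * x⁻¹) = 0 := by
      linear_combination h + (ζ ^ (2 * d * (j + 1))) ^ 2 * hxx
    rcases mul_eq_zero.1 h1 with h2 | h2
    · exact hx1 (2 * d * (j + 1)) 0 (by linear_combination -h2)
    · exact hx2 (2 * d * (j + 1)) 0 (by linear_combination -h2)

end RootsOfUnity

section Divisibility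

open Polynomial

theorem dvd_of_aeval_isPrimitiveRoot_eq_zero {K : Type*} [Field K] [CharZero K] {n : ℕ}
    (hn : 0 < n) {ζ : K} (hζ : IsPrimitiveRoot ζ n) {f : ℚ[X]} (h : aeval ζ f = 0) :
    cyclotomic n ℚ ∣ f := by
  rw [cyclotomic_eq_minpoly_rat hζ hn]
  exact minpoly.dvd ℚ ζ h

theorem C_cyclotomic_dvd_clearedSum {d n t M : ℕ} (hd : 2 ≤ d) (hde : Even d)
    (hn : n = d * (2 * t + 1) + 1) (hM : 2 * M = n + 2 * t + 1) :
    C (cyclotomic n ℚ) ∣ clearedSum d (C X : ℚ[X][X]) X M := by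
  have hn0 : n ≠ 0 := by omega
  have hζ := Complex.isPrimitiveRoot_exp n hn0
  set ζ := Complex.exp (2 * Real.pi * Complex.I / n)
  let φ : ℚ[X] →+* ℂ := (aeval ζ).toRingHom
  have hmap : (clearedSum d (C X : ℚ[X][X]) X M).map φ = clearedSum d (C ζ) X M := by
    rw [← coe_mapRingHom, map_clearedSum]
    simp [φ]
  have hzero : clearedSum d (C ζ) X M = 0 := by
    apply eq_zero_of_infinite_isRoot
    refine Set.infinite_of_injective_forall_mem
      (f := fun k : ℕ ↦ ((k + 2 : ℕ) : ℂ) + ((k + 2 : ℕ) : ℂ)⁻¹) ?_ ?_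
    · intro k l h
      have hk : ((k + 2 : ℕ) : ℂ) ≠ 0 := Nat.cast_ne_zero.2 (by omega)
      have hl : ((l + 2 : ℕ) : ℂ) ≠ 0 := Nat.cast_ne_zero.2 (by omega)
      have h1 : (((k + 2 : ℕ) : ℂ) - ((l + 2 : ℕ) : ℂ)) *
          (((k + 2 : ℕ) : ℂ) * ((l + 2 : ℕ) : ℂ) - 1) = 0 := by
        simp only at h
        field_simp at h
        linear_combination h
      rcases mul_eq_zero.1 h1 with h2 | h2
      · have := Nat.cast_injective (sub_eq_zero.1 h2)
        omega
      · have h3 : (k + 2) * (l + 2) = 1 := by exact_mod_cast sub_eq_zero.1 h2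
        have := Nat.eq_one_of_mul_eq_one_right h3
        omega
    · intro k
      change eval _ _ = 0
      rw [← coe_evalRingHom, map_clearedSum]
      simp only [coe_evalRingHom, eval_C, eval_X]
      refine clearedSum_eq_zero_of_isPrimitiveRoot hd hde hn hM hζ ?_
      rw [Complex.norm_natCast]
      exact_mod_cast (by omega : 1 < k + 2)
  rw [C_dvd_iff_dvd_coeff]
  intro i
  refine dvd_of_aeval_isPrimitiveRoot_eq_zero (by omega) hζ ?_
  have := congrArg (fun p ↦ coeff p i) (hmap.trans hzero)
  simpa [φ] using this

theorem sub_dvd_pow_mul_eval {R K : Type*} [CommRing R] [IsDomain R] [Field K] [Algebra R K]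
    [IsFractionRing R K] {P : R[X]} {s u : R} (hu : u ≠ 0)
    (h : aeval (algebraMap R K s / algebraMap R K u) P = 0) (r : R) :
    u * r - s ∣ u ^ P.natDegree * P.eval r := by
  have h1 : (P.scaleRoots u).eval s = 0 := by
    have := scaleRoots_aeval_eq_zero_of_aeval_div_eq_zero (IsFractionRing.injective R K) h
      (mem_nonZeroDivisors_of_ne_zero hu)
    rw [aeval_algebraMap_apply_eq_algebraMap_eval] at this
    exact (IsFractionRing.injective R K) (by simpa using this)
  have h2 := sub_dvd_eval_sub (u * r) s (P.scaleRoots u)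
  have h3 := scaleRoots_eval₂_mul (p := P) (RingHom.id R) r u
  rw [h1, sub_zero] at h2
  simp only [RingHom.id_apply, eval₂_id] at h3
  rwa [h3] at h2

theorem cyclotomic_pow_three_dvd_clearedSum {d n t M : ℕ} (hd : 2 ≤ d) (hde : Even d)
    (hn : n = d * (2 * t + 1) + 1) (hM : 2 * M = n + 2 * t + 1) :
    cyclotomic n ℚ ^ 3 ∣ clearedSum d (X : ℚ[X]) 2 M := by
  obtain ⟨P, hP⟩ := C_cyclotomic_dvd_clearedSum hd hde hn hM
  have hn0 : 0 < n := by omega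
  have hirr := cyclotomic.irreducible_rat hn0
  let K := FractionRing ℚ[X]
  let q : K := algebraMap ℚ[X] K X
  have hinj : Function.Injective (algebraMap ℚ[X] K) := IsFractionRing.injective _ _
  have hq : q ≠ 0 := (map_ne_zero_iff _ hinj).2 X_ne_zero
  have hroot : clearedSum d q ((q ^ n)⁻¹ + (q ^ n)⁻¹⁻¹) M = 0 := by
    refine clearedSum_pow_eq_zero hd hde hn hM hq (fun i j hij h ↦ hij ?_) fun i j h ↦ ?_
    · have h1 : (X ^ i : ℚ[X]) = X ^ j := hinj (by simpa [sub_eq_zero] using h)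
      simpa using congrArg natDegree h1
    · have h1 : (X ^ i + X ^ j : ℚ[X]) = 0 := hinj (by simpa using h)
      have h2 := congrArg (eval 1) h1
      norm_num at h2
  have hPz : aeval (algebraMap ℚ[X] K (X ^ (2 * n) + 1) / algebraMap ℚ[X] K (X ^ n)) P = 0 := by
    have hz : algebraMap ℚ[X] K (X ^ (2 * n) + 1) / algebraMap ℚ[X] K (X ^ n) =
        (q ^ n)⁻¹ + (q ^ n)⁻¹⁻¹ := by
      simp only [map_add, map_pow, map_one]
      change (q ^ (2 * n) + 1) / q ^ n = _
      rw [div_eq_iff (pow_ne_zero n hq), inv_inv, add_mul, inv_mul_cancel₀ (pow_ne_zero n hq)]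
      ring
    rw [hz]
    have h1 := congrArg (aeval ((q ^ n)⁻¹ + (q ^ n)⁻¹⁻¹)).toRingHom hP
    rw [map_clearedSum] at h1
    simp only [AlgHom.toRingHom_eq_coe, RingHom.coe_coe, aeval_C, aeval_X, map_mul] at h1
    rw [hroot] at h1
    refine (mul_eq_zero.1 h1.symm).resolve_left ?_
    exact (map_ne_zero_iff _ hinj).2 (cyclotomic_ne_zero n ℚ)
  have hdvd := sub_dvd_pow_mul_eval (pow_ne_zero n X_ne_zero) hPz 2
  have hsq : cyclotomic n ℚ ^ 2 ∣ X ^ n * 2 - (X ^ (2 * n) + 1) := by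
    have e : (X ^ n * 2 - (X ^ (2 * n) + 1) : ℚ[X]) = -(X ^ n - 1) ^ 2 := by ring
    rw [e, dvd_neg]
    exact pow_dvd_pow_of_dvd (cyclotomic.dvd_X_pow_sub_one n ℚ) 2
  have hcop : IsCoprime (cyclotomic n ℚ ^ 2) ((X ^ n) ^ P.natDegree) := by
    refine IsCoprime.pow (IsCoprime.pow_right ?_)
    refine (hirr.coprime_iff_not_dvd).2 fun h ↦ ?_
    have h1 := (h.trans (dvd_pow_self X hn0.ne'))
    have h2 := dvd_sub h1 (cyclotomic.dvd_X_pow_sub_one n ℚ)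
    exact hirr.not_isUnit (isUnit_of_dvd_one (by simpa using h2))
  have h2 : cyclotomic n ℚ ^ 2 ∣ P.eval 2 := hcop.dvd_of_dvd_mul_left (hsq.trans hdvd)
  have h3 := congrArg (evalRingHom 2) hP
  rw [map_clearedSum] at h3
  simp only [coe_evalRingHom, eval_C, eval_X, eval_mul] at h3
  rw [h3, pow_succ']
  exact mul_dvd_mul_left _ h2

end Divisibility

theorem prod_numFactor_two {R : Type*} [CommRing R] (d : ℕ) (q : R) (k : ℕ) :
    ∏ j ∈ range k, numFactor d q 2 ((q ^ d) ^ j) =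
      qPoch q (q ^ (2 * d)) k * qPoch (-q) (q ^ (2 * d)) k * qPoch (-(q ^ d)) (q ^ (2 * d)) k *
        (qPoch q (q ^ d) k * qPoch q (q ^ d) k * qPoch (q ^ (d - 1)) (q ^ d) k) := by
  simp only [qPoch, ← prod_mul_distrib]
  refine prod_congr rfl fun j _ ↦ ?_
  rw [numFactor]
  generalize q ^ (d - 1) = r
  ring

theorem prod_denFactor_two {R : Type*} [CommRing R] (d : ℕ) (q : R) (k : ℕ) :
    ∏ j ∈ range k, denFactor d q 2 ((q ^ d) ^ j) =
      qPoch (q ^ d) (q ^ d) k * qPoch (-q) (q ^ d) k * qPoch (-(q ^ d)) (q ^ d) k *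
        (qPoch (q ^ (2 * d)) (q ^ (2 * d)) k * qPoch (q ^ (2 * d)) (q ^ (2 * d)) k *
          qPoch (q ^ (d + 2)) (q ^ (2 * d)) k) := by
  simp only [qPoch, ← prod_mul_distrib]
  refine prod_congr rfl fun j _ ↦ ?_
  rw [denFactor]
  ring

theorem one_sub_mul_sum_eq {K : Type*} [Field K] {q : K} (hq : 1 - q ≠ 0) (d M : ℕ) :
    (1 - q) * ∑ k ∈ range (M + 1),
        qInt q (3 * (d : ℤ) * k + 1) *
          (qPoch q (q ^ (2 * d)) k * qPoch (-q) (q ^ (2 * d)) k *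
            qPoch (-(q ^ d)) (q ^ (2 * d)) k) *
          (qPoch q (q ^ d) k * qPoch q (q ^ d) k * qPoch (q ^ (d - 1)) (q ^ d) k) /
          (qPoch (q ^ d) (q ^ d) k * qPoch (-q) (q ^ d) k * qPoch (-(q ^ d)) (q ^ d) k *
            (qPoch (q ^ (2 * d)) (q ^ (2 * d)) k * qPoch (q ^ (2 * d)) (q ^ (2 * d)) k *
              qPoch (q ^ (d + 2)) (q ^ (2 * d)) k)) *
          q ^ (d * k) =
      ∑ k ∈ range (M + 1), (1 - q * ((q ^ d) ^ k) ^ 3) * (q ^ d) ^ k *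
        ∏ j ∈ range k, numFactor d q 2 ((q ^ d) ^ j) / denFactor d q 2 ((q ^ d) ^ j) := by
  rw [mul_sum]
  refine sum_congr rfl fun k _ ↦ ?_
  have hint : (1 - q) * qInt q (3 * (d : ℤ) * k + 1) = 1 - q * ((q ^ d) ^ k) ^ 3 := by
    have e : (3 * (d : ℤ) * k + 1) = ((3 * d * k + 1 : ℕ) : ℤ) := by push_cast; ring
    rw [qInt, mul_div_cancel₀ _ hq, e, zpow_natCast]
    ring
  rw [prod_div_distrib, prod_numFactor_two, prod_denFactor_two, ← hint, ← pow_mul]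
  ring

theorem prime_not_dvd_cyclotomic_pow_of_aeval_ne_zero {K : Type*} [Field K] [CharZero K] {n : ℕ}
    (hn : 0 < n) {ζ : K} (hζ : IsPrimitiveRoot ζ n) {g p : Polynomial ℚ}
    (hg : Polynomial.aeval ζ g ≠ 0) (hp : Prime p) (hpg : p ∣ g) (m : ℕ) :
    ¬p ∣ Polynomial.cyclotomic n ℚ ^ m := by
  intro h
  have h1 := (hp.irreducible.associated_of_dvd (Polynomial.cyclotomic.irreducible_rat hn)
    (hp.dvd_of_dvd_pow h)).symm.dvd.trans hpg
  rw [Polynomial.cyclotomic_eq_minpoly_rat hζ hn] at h1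
  obtain ⟨f, rfl⟩ := h1
  simp at hg

/-- For even `d ≥ 2` and `n ≡ d+1 (mod 2d)`,
`Σ_{k=0}^{(dn+n-1)/(2d)} [3dk+1] (q,-q,-q^d;q^{2d})_k (q,q,q^{d-1};q^d)_k /
((q^d,-q,-q^d;q^d)_k (q^{2d},q^{2d},q^{d+2};q^{2d})_k) · q^{dk} ≡ 0 (mod Φ_n(q)^3)`. -/
theorem stmt2 (d : ℕ) (hd2 : 2 ≤ d) (hdeven : Even d) (n : ℕ) (hn : 0 < n)
    (hmod : n % (2 * d) = (d + 1) % (2 * d)) :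
    CongrMod1
      (∑ k ∈ Finset.range ((d * n + n - 1) / (2 * d) + 1),
        qInt qv (3 * (d : ℤ) * k + 1) *
          (qPoch qv (qv ^ (2 * d)) k * qPoch (-qv) (qv ^ (2 * d)) k *
            qPoch (-(qv ^ d)) (qv ^ (2 * d)) k) *
          (qPoch qv (qv ^ d) k * qPoch qv (qv ^ d) k * qPoch (qv ^ (d - 1)) (qv ^ d) k) /
          (qPoch (qv ^ d) (qv ^ d) k * qPoch (-qv) (qv ^ d) k * qPoch (-(qv ^ d)) (qv ^ d) k *
            (qPoch (qv ^ (2 * d)) (qv ^ (2 * d)) k * qPoch (qv ^ (2 * d)) (qv ^ (2 * d)) k *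
              qPoch (qv ^ (d + 2)) (qv ^ (2 * d)) k)) *
          qv ^ (d * k))
      0 (Polynomial.cyclotomic n ℚ ^ 3) := by
  obtain ⟨t, ht⟩ : ∃ t, n = d * (2 * t + 1) + 1 := by
    refine ⟨n / (2 * d), ?_⟩
    have h1 := Nat.mod_add_div n (2 * d)
    rw [hmod, Nat.mod_eq_of_lt (by omega)] at h1
    linear_combination -h1
  obtain ⟨M, hM⟩ : ∃ M, 2 * M = n + 2 * t + 1 := by
    obtain ⟨e, he⟩ := hdeven.mul_right (2 * t + 1)
    exact ⟨e + t + 1, by omega⟩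
  have hMdiv : (d * n + n - 1) / (2 * d) = M := by
    apply Nat.div_eq_of_eq_mul_right (by omega)
    have h1 : d * (2 * M) = d * (n + 2 * t + 1) := by rw [hM]
    have h2 : d * n + n = 2 * d * M + 1 := by
      rw [ht] at h1 ⊢
      linear_combination -h1
    omega
  rw [hMdiv]
  have hinj : Function.Injective (algebraMap R1 K1) := IsFractionRing.injective _ _
  obtain ⟨f, hf⟩ := cyclotomic_pow_three_dvd_clearedSum hd2 hdeven ht hM
  have hζ := Complex.isPrimitiveRoot_exp n hn.ne'
  set ζ := Complex.exp (2 * Real.pi * Complex.I / n)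
  let den : R1 :=
    ∏ j ∈ range M, denFactor d (Polynomial.X : R1) 2 ((Polynomial.X ^ d) ^ j)
  let g : R1 := (1 - Polynomial.X) * den
  have hgζ : Polynomial.aeval ζ g ≠ 0 := by
    have h1 : 1 - ζ ≠ 0 := sub_ne_zero.2 (hζ.ne_one (by rw [ht]; nlinarith)).symm
    simp only [g, den, map_mul, map_sub, map_one, Polynomial.aeval_X, map_prod]
    refine mul_ne_zero h1 (prod_ne_zero_iff.2 fun j hj ↦ ?_)
    have hj := mem_range.1 hj
    have h2 := map_denFactor (Polynomial.aeval ζ).toRingHom d (Polynomial.X : R1) 2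
      ((Polynomial.X ^ d) ^ j)
    simp only [AlgHom.toRingHom_eq_coe, RingHom.coe_coe, map_pow, Polynomial.aeval_X,
      map_ofNat] at h2
    rw [h2]
    refine denFactor_ne_zero_of_isPrimitiveRoot hd2 hdeven ht hM hj hζ fun h ↦ ?_
    refine not_dvd_two_mul_mul_succ hd2 hdeven ht hM hj ((hζ.pow_eq_one_iff_dvd _).1 ?_)
    have h3 : (ζ ^ (2 * d * (j + 1)) - 1) ^ 2 = 0 := by linear_combination h
    exact sub_eq_zero.1 (pow_eq_zero_iff two_ne_zero |>.1 h3)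
  have hg0 : g ≠ 0 := by
    rintro h
    simp [h] at hgζ
  refine ⟨f, g, hg0, fun p hp hpg ↦
    prime_not_dvd_cyclotomic_pow_of_aeval_ne_zero hn hζ hgζ hp hpg 3, ?_⟩
  have hq : 1 - qv ≠ 0 := by
    have := (map_ne_zero_iff _ hinj).2 (left_ne_zero_of_mul hg0)
    simpa [qv] using this
  have hden : algebraMap R1 K1 den = ∏ j ∈ range M, denFactor d qv 2 ((qv ^ d) ^ j) := by
    simp only [den, map_prod, map_denFactor, map_pow, map_ofNat]
    rfl
  have hden0 (j : ℕ) (hj : j < M) : denFactor d qv 2 ((qv ^ d) ^ j) ≠ 0 := by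
    have h1 := (map_ne_zero_iff _ hinj).2 (right_ne_zero_of_mul hg0)
    rw [hden] at h1
    exact prod_ne_zero_iff.1 h1 j (mem_range.2 hj)
  have hg : algebraMap R1 K1 g = (1 - qv) * algebraMap R1 K1 den := by
    simp only [g, map_mul, map_sub, map_one]
    rfl
  rw [sub_zero, ← map_mul, ← hf, map_clearedSum, hg, hden, map_ofNat, mul_comm _ (_ * _),
    mul_right_comm, one_sub_mul_sum_eq hq, mul_comm]
  exact (clearedSum_eq hden0).symm

end
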